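/- In the net setting for distance-regular graphs with d → ∞ and Assumption (DR), suppose additionally that each Γ_λ has classical parameters (d, q, α, β) with d ≥ 3 and q ∈ ℤ, |q| ≥ 2. Then q eventually takes at most three values. If q is eventually constant, then so is α, and: (i) if α ≠ 0, then β/√k is eventually bounded and there exist real scalars γ and ρ with ρ > 0 and γ(ρ + α/ρ) > −1 such that t√k → γ and every accumulation point of β/√k lies in {ρ, α/ρ}; moreover ρ = √(−α) if q < 0; (ii) if α = 0, then there exist real scalars γ and ρ with ρ ≥ 0 and γρ > −1 such that t√k → γ and β/√k → ρ. If q is not convergent, then there exists a subnet of (Γ_λ) on which q is eventually constant and case (ii) holds with ρ = 0. -/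

import Mathlib

open Matrix Filter

/-- A (bundled) distance-regular graph: a finite connected simple graph of diameter `d`
with intersection numbers `a i`, `b i`, `c i` for `0 ≤ i ≤ d`; `b 0` is the valency `k`. -/
structure DRG where
  X : Type
  fin : Fintype X
  G : SimpleGraph X
  d : ℕ
  a : ℕ → ℕ
  b : ℕ → ℕ
  c : ℕ → ℕ
  conn : G.Connected
  dist_le : ∀ x y : X, G.dist x y ≤ d
  dist_eq : ∃ x y : X, G.dist x y = d
  bd : b d = 0
  c0 : c 0 = 0
  count_c : ∀ i ≤ d, ∀ x y : X, G.dist x y = i →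
      {z : X | G.Adj y z ∧ G.dist x z = i - 1}.ncard = c i
  count_a : ∀ i ≤ d, ∀ x y : X, G.dist x y = i →
      {z : X | G.Adj y z ∧ G.dist x z = i}.ncard = a i
  count_b : ∀ i ≤ d, ∀ x y : X, G.dist x y = i →
      {z : X | G.Adj y z ∧ G.dist x z = i + 1}.ncard = b i

attribute [instance] DRG.fin

noncomputable instance (Γ : DRG) : DecidableEq Γ.X := Classical.decEq _

noncomputable instance (Γ : DRG) : DecidableRel Γ.G.Adj := fun _ _ => Classical.dec _

namespace DRG

variable (Γ : DRG)

/-- The `i`-th distance matrix (over `ℂ`). -/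
noncomputable def Amat (i : ℕ) : Matrix Γ.X Γ.X ℂ :=
  Matrix.of fun x y => if Γ.G.dist x y = i then 1 else 0

/-- The adjacency algebra `A(Γ) = span_ℂ {A_0, …, A_d}`. -/
noncomputable def adjAlg : Submodule ℂ (Matrix Γ.X Γ.X ℂ) :=
  Submodule.span ℂ {M | ∃ i ≤ Γ.d, M = Γ.Amat i}

/-- The matrix `K_t = (t^{∂(x,y)})_{x,y}` (over `ℝ`). -/
noncomputable def Kmat (t : ℝ) : Matrix Γ.X Γ.X ℝ :=
  Matrix.of fun x y => t ^ Γ.G.dist x y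

/-- `t ∈ π(Γ)`, i.e. `K_t` is positive semidefinite. -/
def piMem (t : ℝ) : Prop := (Γ.Kmat t).PosSemidef

/-- The Gibbs functional `φ_t(B) = ∑_x t^{∂(x,o)} B_{x,o}` with base vertex `o`. -/
noncomputable def gibbs (t : ℝ) (o : Γ.X) (B : Matrix Γ.X Γ.X ℂ) : ℂ :=
  ∑ x : Γ.X, (t : ℂ) ^ Γ.G.dist x o * B x o

end DRG

/-- The Gaussian binomial `[i]_q = 1 + q + ⋯ + q^{i-1}`. -/
noncomputable def gaussOne (q : ℝ) (i : ℕ) : ℝ := ∑ h ∈ Finset.range i, q ^ h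

/-- `Γ` has classical parameters `(d, q, α, β)`. -/
def DRG.HasClassical (Γ : DRG) (q α β : ℝ) : Prop :=
  (∀ i ≤ Γ.d, (Γ.b i : ℝ) = (gaussOne q Γ.d - gaussOne q i) * (β - α * gaussOne q i)) ∧
  (∀ i ≤ Γ.d, (Γ.c i : ℝ) = gaussOne q i * (1 + α * gaussOne q (i - 1)))

section Net

variable {Λ : Type*} [Preorder Λ] [IsDirected Λ (· ≤ ·)] [Nonempty Λ]

/-- The variance `Σ_t²(A) = k(1−t)(1+t+t·a₁)` as a function of the net index. -/
noncomputable def sig2 (Γ : Λ → DRG) (t : Λ → ℝ) (l : Λ) : ℝ :=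
  ((Γ l).b 0 : ℝ) * (1 - t l) * (1 + t l + t l * ((Γ l).a 1 : ℝ))

/-- `ω̄_i = c_i b_{i−1} / Σ_t²(A)`. -/
noncomputable def omegaBar (Γ : Λ → DRG) (t : Λ → ℝ) (i : ℕ) (l : Λ) : ℝ :=
  (((Γ l).c i : ℝ) * ((Γ l).b (i - 1) : ℝ)) / sig2 Γ t l

/-- `ᾱ_i = (a_{i−1} − t·k) / Σ_t(A)`. -/
noncomputable def alphaBar (Γ : Λ → DRG) (t : Λ → ℝ) (i : ℕ) (l : Λ) : ℝ :=
  (((Γ l).a (i - 1) : ℝ) - t l * ((Γ l).b 0 : ℝ)) / Real.sqrt (sig2 Γ t l)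

/-- `k_i = (b₀⋯b_{i−1})/(c₁⋯c_i)` as a real number. -/
noncomputable def kiProd (Γ : Λ → DRG) (i : ℕ) (l : Λ) : ℝ :=
  (∏ h ∈ Finset.range i, ((Γ l).b h : ℝ)) / (∏ h ∈ Finset.range i, ((Γ l).c (h + 1) : ℝ))

/-- `γ̄_i = t^i √(k_i)`. -/
noncomputable def gammaBar (Γ : Λ → DRG) (t : Λ → ℝ) (i : ℕ) (l : Λ) : ℝ :=
  t l ^ i * Real.sqrt (kiProd Γ i l)

/-- Assumption (DR): for every `i ≥ 1` the limits `ω_i = lim ω̄_i` and `α_i = lim ᾱ_i`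
exist (with prescribed values `ω i`, `αl i`) and `ω_i > 0`. -/
def AssumptionDR (Γ : Λ → DRG) (t : Λ → ℝ) (ω αl : ℕ → ℝ) : Prop :=
  ∀ i : ℕ, 1 ≤ i → 0 < ω i ∧ Tendsto (omegaBar Γ t i) atTop (nhds (ω i)) ∧
    Tendsto (alphaBar Γ t i) atTop (nhds (αl i))

end Net

theorem gaussOne_zero (q : ℝ) : gaussOne q 0 = 0 := by simp [gaussOne]

theorem gaussOne_succ (q : ℝ) (n : ℕ) : gaussOne q (n + 1) = q * gaussOne q n + 1 :=
  geom_sum_succ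

theorem gaussOne_one (q : ℝ) : gaussOne q 1 = 1 := by simp [gaussOne]

theorem gaussOne_two (q : ℝ) : gaussOne q 2 = 1 + q := by
  rw [gaussOne_succ, gaussOne_one]; ring

theorem gaussOne_three (q : ℝ) : gaussOne q 3 = 1 + q + q ^ 2 := by
  rw [gaussOne_succ, gaussOne_two]; ring

theorem abs_gaussOne_lower {q : ℝ} (hq : 2 ≤ |q|) (n : ℕ) :
    1 + 2 ^ n * |q| ≤ |gaussOne q (n + 3)| := by
  induction n with
  | zero =>
    rw [zero_add, gaussOne_three]
    refine le_trans ?_ (le_abs_self _)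
    have h1 : |q| ^ 2 = q ^ 2 := sq_abs q
    have h2 := neg_abs_le q
    nlinarith
  | succ n ih =>
    rw [show n + 1 + 3 = n + 3 + 1 by ring, gaussOne_succ]
    have h1 : |q * gaussOne q (n + 3)| ≤ |q * gaussOne q (n + 3) + 1| + 1 := by
      have := abs_sub (q * gaussOne q (n + 3) + 1) 1
      simpa using this
    rw [abs_mul] at h1
    have h2 : 2 * |gaussOne q (n + 3)| ≤ |q| * |gaussOne q (n + 3)| :=
      mul_le_mul_of_nonneg_right hq (abs_nonneg _)
    rw [pow_succ]
    linarith

theorem one_le_abs_gaussOne {q : ℝ} (hq : 2 ≤ |q|) {n : ℕ} (hn : 3 ≤ n) :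
    1 ≤ |gaussOne q n| := by
  obtain ⟨m, rfl⟩ := Nat.exists_eq_add_of_le' hn
  have := abs_gaussOne_lower hq m
  have : 0 ≤ 2 ^ m * |q| := by positivity
  linarith

theorem gaussOne_div_succ_le_half {q : ℝ} (hq : 2 ≤ |q|) {n : ℕ} (hn : 3 ≤ n) :
    gaussOne q n / gaussOne q (n + 1) ≤ 1 / 2 := by
  have h1 := one_le_abs_gaussOne hq hn
  rw [gaussOne_succ]
  rcases le_abs.1 hq with h | h
  · have hg : 0 ≤ gaussOne q n := Finset.sum_nonneg fun i _ => pow_nonneg (by linarith) i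
    rw [div_le_div_iff₀ (by nlinarith) two_pos]
    nlinarith
  · refine le_trans ?_ (by norm_num : (0 : ℝ) ≤ 1 / 2)
    rcases le_abs.1 h1 with h2 | h2
    · exact div_nonpos_of_nonneg_of_nonpos (by linarith) (by nlinarith)
    · exact div_nonpos_of_nonpos_of_nonneg (by linarith) (by nlinarith)

theorem abs_gaussOne_div_le {q : ℝ} (hq : 2 ≤ |q|) {i n : ℕ} (hi : i ≤ 2) (hn : 3 ≤ n) :
    |gaussOne q i| / |gaussOne q n| ≤ 16 * (1 / 2) ^ n := by
  obtain ⟨m, rfl⟩ := Nat.exists_eq_add_of_le' hn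
  have h1 := abs_gaussOne_lower hq m
  have h2 : |gaussOne q i| ≤ 2 * |q| := by
    interval_cases i
    · rw [gaussOne_zero, abs_zero]; linarith
    · rw [gaussOne_one, abs_one]; linarith
    · rw [gaussOne_two]
      have := abs_add_le 1 q
      rw [abs_one] at this
      linarith
  have h3 : (0 : ℝ) < 2 ^ m := by positivity
  have h4 : (16 : ℝ) * (1 / 2) ^ (m + 3) = 2 / 2 ^ m := by
    rw [pow_add, _root_.one_div_pow]; ring
  rw [h4, div_le_div_iff₀ (by nlinarith) h3]
  nlinarith

namespace DRG

theorem exists_dist_eq (Γ : DRG) {i : ℕ} (hi : i ≤ Γ.d) : ∃ x y : Γ.X, Γ.G.dist x y = i := by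
  induction hi using Nat.decreasingInduction with
  | self => exact Γ.dist_eq
  | of_succ j _ ih =>
    obtain ⟨x, y, hxy⟩ := ih
    obtain ⟨p, hp⟩ := Γ.conn.exists_walk_length_eq_dist y x
    rw [SimpleGraph.dist_comm, hxy] at hp
    cases p with
    | nil => simp at hp
    | @cons _ z _ hadj p =>
      refine ⟨x, z, le_antisymm ?_ ?_⟩
      · rw [SimpleGraph.dist_comm]
        refine (SimpleGraph.dist_le p).trans ?_
        simpa using hp.le
      · have := Γ.conn.dist_triangle (u := x) (v := z) (w := y)
        rw [SimpleGraph.dist_eq_one_iff_adj.2 hadj.symm] at this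
        omega

theorem a_zero (Γ : DRG) : Γ.a 0 = 0 := by
  obtain ⟨x, y, hxy⟩ := Γ.exists_dist_eq (Nat.zero_le _)
  rw [← Γ.count_a 0 (Nat.zero_le _) x y hxy, Set.ncard_eq_zero]
  ext z
  obtain rfl := Γ.conn.dist_eq_zero_iff.1 hxy
  simp only [Set.mem_ofPred_eq, Set.mem_empty_iff_false, iff_false, not_and]
  intro hadj hz
  exact hadj.ne (Γ.conn.dist_eq_zero_iff.1 hz)

theorem a_add_b_add_c (Γ : DRG) {i : ℕ} (h1 : 1 ≤ i) (hi : i ≤ Γ.d) :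
    Γ.a i + Γ.b i + Γ.c i = Γ.b 0 := by
  obtain ⟨x, y, hxy⟩ := Γ.exists_dist_eq hi
  have hb := Γ.count_b 0 (Nat.zero_le _) y y SimpleGraph.dist_self
  rw [← Γ.count_a i hi x y hxy, ← Γ.count_b i hi x y hxy, ← Γ.count_c i hi x y hxy, ← hb,
    ← Set.ncard_union_eq, ← Set.ncard_union_eq]
  · congr 1
    ext z
    simp only [Set.mem_union, Set.mem_ofPred_eq, zero_add, SimpleGraph.dist_eq_one_iff_adj, and_self]
    constructor
    · tauto
    · intro h
      have := h.diff_dist_adj (u := x)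
      rw [hxy] at this
      tauto
  · rw [Set.disjoint_left]
    simp only [Set.mem_union, Set.mem_ofPred_eq]
    omega
  · rw [Set.disjoint_left]
    simp only [Set.mem_ofPred_eq]
    omega

namespace HasClassical

variable {Γ : DRG} {q α β : ℝ}

theorem b_zero (h : Γ.HasClassical q α β) : (Γ.b 0 : ℝ) = gaussOne q Γ.d * β := by
  rw [h.1 0 (Nat.zero_le _), gaussOne_zero]; ring

theorem c_two (h : Γ.HasClassical q α β) (hd : 2 ≤ Γ.d) : (Γ.c 2 : ℝ) = (1 + q) * (1 + α) := by
  rw [h.2 2 hd, gaussOne_two, gaussOne_one, mul_one]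

theorem c_three (h : Γ.HasClassical q α β) (hd : 3 ≤ Γ.d) :
    (Γ.c 3 : ℝ) = (1 + q + q ^ 2) * (1 + α * (1 + q)) := by
  rw [h.2 3 hd, gaussOne_three, gaussOne_two]

theorem a_eq (h : Γ.HasClassical q α β) {i : ℕ} (h1 : 1 ≤ i) (hi : i ≤ Γ.d) :
    (Γ.a i : ℝ) = gaussOne q i * (β + α * gaussOne q Γ.d) - α * gaussOne q i ^ 2 - Γ.c i := by
  have hs : (Γ.a i : ℝ) + Γ.b i + Γ.c i = Γ.b 0 := by exact_mod_cast Γ.a_add_b_add_c h1 hi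
  rw [h.1 i hi, h.b_zero] at hs
  linear_combination hs

theorem a_one (h : Γ.HasClassical q α β) (hd : 1 ≤ Γ.d) :
    (Γ.a 1 : ℝ) = β + α * gaussOne q Γ.d - α - 1 := by
  rw [h.a_eq le_rfl hd, h.2 1 hd, gaussOne_one, gaussOne_zero]; ring

theorem b_div (h : Γ.HasClassical q α β) (hk : Γ.b 0 ≠ 0) {i : ℕ} (hi : i ≤ Γ.d) :
    (Γ.b i : ℝ) / Γ.b 0 = (1 - gaussOne q i / gaussOne q Γ.d) * (1 - α / β * gaussOne q i) := by
  have hk' : (Γ.b 0 : ℝ) ≠ 0 := by exact_mod_cast hk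
  rw [h.b_zero] at hk' ⊢
  have h1 := left_ne_zero_of_mul hk'
  have h2 := right_ne_zero_of_mul hk'
  rw [h.1 i hi]
  field_simp

theorem abs_div_mul_le (h : Γ.HasClassical q α β) (hq : 2 ≤ |q|) (hk : Γ.b 0 ≠ 0)
    (hd : 4 ≤ Γ.d) : |α / β| * |gaussOne q (Γ.d - 1)| ≤ 1 := by
  have h1 := h.b_div hk (Nat.sub_le Γ.d 1)
  have h2 : Γ.b (Γ.d - 1) ≤ Γ.b 0 := by
    have := Γ.a_add_b_add_c (i := Γ.d - 1) (by omega) (by omega)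
    omega
  have h3 : (Γ.b (Γ.d - 1) : ℝ) / Γ.b 0 ≤ 1 :=
    div_le_one_of_le₀ (by exact_mod_cast h2) (Nat.cast_nonneg _)
  have h4 : 0 ≤ (Γ.b (Γ.d - 1) : ℝ) / Γ.b 0 := by positivity
  have h5 := gaussOne_div_succ_le_half hq (n := Γ.d - 1) (by omega)
  rw [Nat.sub_add_cancel (by omega : 1 ≤ Γ.d)] at h5
  rw [h1] at h3 h4
  rw [← abs_mul, abs_le]
  constructor <;> nlinarith

theorem abs_div_mul_gaussOne_le (h : Γ.HasClassical q α β) (hq : 2 ≤ |q|) (hk : Γ.b 0 ≠ 0)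
    (hd : 4 ≤ Γ.d) {i : ℕ} (hi : i ≤ 2) :
    |α / β * gaussOne q i| ≤ 32 * (1 / 2) ^ Γ.d := by
  have h1 := h.abs_div_mul_le hq hk hd
  have h2 := abs_gaussOne_div_le hq hi (n := Γ.d - 1) (by omega)
  have h3 := one_le_abs_gaussOne hq (n := Γ.d - 1) (by omega)
  have h4 : |α / β| ≤ 1 / |gaussOne q (Γ.d - 1)| := (le_div_iff₀ (by linarith)).2 h1
  have h5 : (32 : ℝ) * (1 / 2) ^ Γ.d = 16 * (1 / 2) ^ (Γ.d - 1) := by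
    obtain ⟨m, hm⟩ := Nat.exists_eq_add_of_le' hd
    rw [hm, show m + 4 - 1 = m + 3 by omega]; ring
  rw [abs_mul, h5]
  refine le_trans (mul_le_mul_of_nonneg_right h4 (abs_nonneg _)) ?_
  rwa [one_div_mul_eq_div]

theorem two_pow_le (h : Γ.HasClassical q α β) (hq : 2 ≤ |q|) (hk : Γ.b 0 ≠ 0) (hd : 4 ≤ Γ.d) :
    (2 : ℝ) ^ Γ.d ≤ 16 * Γ.b 0 := by
  have h1 := h.abs_div_mul_le hq hk hd
  have hβ : β ≠ 0 := by
    rintro rfl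
    exact hk (by exact_mod_cast h.b_zero.trans (mul_zero _))
  have hg : gaussOne q Γ.d = q * gaussOne q (Γ.d - 1) + 1 := by
    rw [← gaussOne_succ, Nat.sub_add_cancel (by omega)]
  rw [abs_div, div_mul_eq_mul_div, div_le_one (abs_pos.2 hβ)] at h1
  have h2 : 1 ≤ |β| * (1 + |q|) := by
    have ha : (0 : ℝ) ≤ Γ.a 1 := Nat.cast_nonneg _
    rw [h.a_one (by omega), hg] at ha
    have h3 : 1 ≤ |β + q * (α * gaussOne q (Γ.d - 1))| :=
      le_trans (by linarith) (le_abs_self _)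
    have h4 := h3.trans (abs_add_le _ _)
    rw [abs_mul, abs_mul] at h4
    nlinarith [mul_le_mul_of_nonneg_left h1 (abs_nonneg q)]
  obtain ⟨m, hm⟩ := Nat.exists_eq_add_of_le' (show 3 ≤ Γ.d by omega)
  have h5 := abs_gaussOne_lower hq m
  rw [← hm] at h5
  have hk' : (Γ.b 0 : ℝ) = |gaussOne q Γ.d| * |β| := by
    rw [← abs_mul, ← h.b_zero, Nat.abs_cast]
  have h6 : 2 ^ m * (|q| * |β|) ≤ |gaussOne q Γ.d| * |β| := by
    rw [← mul_assoc]
    exact mul_le_mul_of_nonneg_right (by linarith) (abs_nonneg _)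
  have h7 : 1 ≤ 2 * (|q| * |β|) := by nlinarith [abs_nonneg β]
  rw [hk']
  have h9 : (2 : ℝ) ^ Γ.d = 2 ^ m * 8 := by rw [hm, pow_add]; norm_num
  have h8 := mul_le_mul_of_nonneg_left h7 (pow_nonneg (zero_le_two (α := ℝ)) m)
  linarith

end HasClassical

end DRG

theorem exists_nat_of_tendsto_natCast {ι : Type*} {F : Filter ι} [F.NeBot] {u : ι → ℕ} {w : ℝ}
    (h : Tendsto (fun l => (u l : ℝ)) F (nhds w)) : ∃ n : ℕ, w = n ∧ ∀ᶠ l in F, u l = n := by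
  have hmem : w ∈ Set.range ((↑) : ℕ → ℝ) :=
    Nat.isClosedEmbedding_coe_real.isClosed_range.mem_of_tendsto h
      (Eventually.of_forall fun l => ⟨u l, rfl⟩)
  obtain ⟨n, rfl⟩ := hmem
  refine ⟨n, rfl, ?_⟩
  have h' : Tendsto u F (nhds n) := Nat.isClosedEmbedding_coe_real.isInducing.tendsto_nhds_iff.2 h
  rwa [nhds_discrete, tendsto_pure] at h'

section ClassicalNet

variable {Λ : Type*} {Γ : Λ → DRG} {t : Λ → ℝ} {q : Λ → ℤ} {αp βp : Λ → ℝ} {ω αl : ℕ → ℝ}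

theorem b_zero_ne_zero_of_sig2_pos {l : Λ} (h : 0 < sig2 Γ t l) : (Γ l).b 0 ≠ 0 := by
  intro h0
  simp [sig2, h0] at h

theorem sqrt_b_zero_pos_of_sig2_pos {l : Λ} (h : 0 < sig2 Γ t l) :
    0 < Real.sqrt ((Γ l).b 0) :=
  Real.sqrt_pos.2 (by exact_mod_cast Nat.pos_of_ne_zero (b_zero_ne_zero_of_sig2_pos h))

theorem two_le_abs_intCast {m : ℤ} (h : 2 ≤ |m|) : (2 : ℝ) ≤ |(m : ℝ)| := by
  exact_mod_cast h

theorem beta_div_mul_alpha_div (hvar : ∀ l : Λ, 0 < sig2 Γ t l)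
    (hcp : ∀ l : Λ, (Γ l).HasClassical ((q l : ℤ) : ℝ) (αp l) (βp l)) (α : ℝ) (l : Λ) :
    βp l / Real.sqrt ((Γ l).b 0) * (α * gaussOne (q l) (Γ l).d / Real.sqrt ((Γ l).b 0)) = α := by
  have h1 : ((Γ l).b 0 : ℝ) ≠ 0 := by exact_mod_cast b_zero_ne_zero_of_sig2_pos (hvar l)
  rw [div_mul_div_comm, Real.mul_self_sqrt (Nat.cast_nonneg _), div_eq_iff h1, (hcp l).b_zero]
  ring

theorem alpha_eq_of_c_two (hcp : ∀ l : Λ, (Γ l).HasClassical ((q l : ℤ) : ℝ) (αp l) (βp l))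
    (hq2 : ∀ l : Λ, 2 ≤ |q l|) {l : Λ} (hd : 2 ≤ (Γ l).d) :
    αp l = (Γ l).c 2 / (1 + q l) - 1 := by
  have h : (1 + q l : ℝ) ≠ 0 := by
    intro h0
    have h1 : 1 + q l = 0 := by exact_mod_cast h0
    have h2 := hq2 l
    rw [show q l = -1 by omega] at h2
    norm_num at h2
  rw [(hcp l).c_two hd]
  field_simp
  ring

theorem c_three_eq (hcp : ∀ l : Λ, (Γ l).HasClassical ((q l : ℤ) : ℝ) (αp l) (βp l))
    {l : Λ} (hd : 3 ≤ (Γ l).d) :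
    ((Γ l).c 3 : ℤ) = (1 + q l + q l ^ 2) * ((Γ l).c 2 - q l) := by
  have h1 := (hcp l).c_two (by omega)
  have h2 := (hcp l).c_three hd
  have : ((Γ l).c 3 : ℝ) = (1 + q l + q l ^ 2) * ((Γ l).c 2 - q l) := by
    rw [h1, h2]; ring
  exact_mod_cast this

variable [Preorder Λ]

theorem tendsto_b_zero_atTop (hvar : ∀ l : Λ, 0 < sig2 Γ t l)
    (hd : Tendsto (fun l : Λ => (Γ l).d) atTop atTop) (hq2 : ∀ l : Λ, 2 ≤ |q l|)
    (hcp : ∀ l : Λ, (Γ l).HasClassical ((q l : ℤ) : ℝ) (αp l) (βp l)) :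
    Tendsto (fun l : Λ => ((Γ l).b 0 : ℝ)) atTop atTop := by
  have h1 : Tendsto (fun l : Λ => (2 : ℝ) ^ (Γ l).d / 16) atTop atTop :=
    ((tendsto_pow_atTop_atTop_of_one_lt one_lt_two).comp hd).atTop_div_const (by norm_num)
  refine tendsto_atTop_mono' _ ?_ h1
  filter_upwards [hd.eventually_ge_atTop 4] with l hl
  rw [div_le_iff₀' (by norm_num)]
  exact (hcp l).two_pow_le (two_le_abs_intCast (hq2 l)) (b_zero_ne_zero_of_sig2_pos (hvar l)) hl

theorem tendsto_b_div_b_zero (hvar : ∀ l : Λ, 0 < sig2 Γ t l)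
    (hd : Tendsto (fun l : Λ => (Γ l).d) atTop atTop) (hq2 : ∀ l : Λ, 2 ≤ |q l|)
    (hcp : ∀ l : Λ, (Γ l).HasClassical ((q l : ℤ) : ℝ) (αp l) (βp l)) {i : ℕ} (hi : i ≤ 2) :
    Tendsto (fun l : Λ => ((Γ l).b i : ℝ) / (Γ l).b 0) atTop (nhds 1) := by
  have hpow : Tendsto (fun l : Λ => ((1 : ℝ) / 2) ^ (Γ l).d) atTop (nhds 0) :=
    (tendsto_pow_atTop_nhds_zero_of_lt_one (by norm_num) (by norm_num)).comp hd
  have h1 : Tendsto (fun l : Λ => gaussOne (q l) i / gaussOne (q l) (Γ l).d) atTop (nhds 0) := by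
    refine squeeze_zero_norm' ?_ (by simpa only [mul_zero] using hpow.const_mul 16)
    filter_upwards [hd.eventually_ge_atTop 4] with l hl
    rw [Real.norm_eq_abs, abs_div]
    exact abs_gaussOne_div_le (two_le_abs_intCast (hq2 l)) hi (by omega)
  have h2 : Tendsto (fun l : Λ => αp l / βp l * gaussOne (q l) i) atTop (nhds 0) := by
    refine squeeze_zero_norm' ?_ (by simpa only [mul_zero] using hpow.const_mul 32)
    filter_upwards [hd.eventually_ge_atTop 4] with l hl
    exact (hcp l).abs_div_mul_gaussOne_le (two_le_abs_intCast (hq2 l))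
      (b_zero_ne_zero_of_sig2_pos (hvar l)) hl hi
  have h3 := (h1.const_sub 1).mul (h2.const_sub 1)
  simp only [sub_zero, mul_one] at h3
  refine h3.congr' ?_
  filter_upwards [hd.eventually_ge_atTop 4] with l hl
  exact ((hcp l).b_div (b_zero_ne_zero_of_sig2_pos (hvar l)) (by omega)).symm

theorem tendsto_b_zero_div_sig2 (hd : Tendsto (fun l : Λ => (Γ l).d) atTop atTop)
    (hcp : ∀ l : Λ, (Γ l).HasClassical ((q l : ℤ) : ℝ) (αp l) (βp l))
    (hDR : AssumptionDR Γ t ω αl) :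
    Tendsto (fun l : Λ => ((Γ l).b 0 : ℝ) / sig2 Γ t l) atTop (nhds (ω 1)) := by
  refine (hDR 1 le_rfl).2.1.congr' ?_
  filter_upwards [hd.eventually_ge_atTop 1] with l hl
  have : ((Γ l).c 1 : ℝ) = 1 := by
    rw [(hcp l).2 1 hl, gaussOne_one, gaussOne_zero]; ring
  rw [omegaBar, this, one_mul]

theorem tendsto_sqrt_sig2_div (hvar : ∀ l : Λ, 0 < sig2 Γ t l)
    (hd : Tendsto (fun l : Λ => (Γ l).d) atTop atTop)
    (hcp : ∀ l : Λ, (Γ l).HasClassical ((q l : ℤ) : ℝ) (αp l) (βp l))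
    (hDR : AssumptionDR Γ t ω αl) :
    Tendsto (fun l : Λ => Real.sqrt (sig2 Γ t l) / Real.sqrt ((Γ l).b 0)) atTop
      (nhds (Real.sqrt (ω 1))⁻¹) := by
  have h := ((tendsto_b_zero_div_sig2 hd hcp hDR).sqrt).inv₀
    (Real.sqrt_ne_zero'.2 (hDR 1 le_rfl).1)
  refine h.congr fun l => ?_
  rw [Real.sqrt_div' _ (hvar l).le, inv_div]

theorem tendsto_a_sub_div_sqrt (hvar : ∀ l : Λ, 0 < sig2 Γ t l)
    (hd : Tendsto (fun l : Λ => (Γ l).d) atTop atTop)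
    (hcp : ∀ l : Λ, (Γ l).HasClassical ((q l : ℤ) : ℝ) (αp l) (βp l))
    (hDR : AssumptionDR Γ t ω αl) (i : ℕ) :
    Tendsto (fun l : Λ => ((Γ l).a i : ℝ) / Real.sqrt ((Γ l).b 0)
        - t l * Real.sqrt ((Γ l).b 0)) atTop
      (nhds (αl (i + 1) * (Real.sqrt (ω 1))⁻¹)) := by
  refine ((hDR (i + 1) (by omega)).2.2.mul (tendsto_sqrt_sig2_div hvar hd hcp hDR)).congr
    fun l => ?_
  have h1 := (Real.sqrt_pos.2 (hvar l)).ne'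
  have h2 := (sqrt_b_zero_pos_of_sig2_pos (hvar l)).ne'
  have h3 : ((Γ l).b 0 : ℝ) = Real.sqrt ((Γ l).b 0) * Real.sqrt ((Γ l).b 0) :=
    (Real.mul_self_sqrt (Nat.cast_nonneg _)).symm
  rw [alphaBar, Nat.add_sub_cancel, div_mul_div_cancel₀ h1, sub_div]
  congr 1
  nth_rw 1 [h3]
  field_simp

theorem exists_tendsto_t_mul_sqrt (hvar : ∀ l : Λ, 0 < sig2 Γ t l)
    (hd : Tendsto (fun l : Λ => (Γ l).d) atTop atTop)
    (hcp : ∀ l : Λ, (Γ l).HasClassical ((q l : ℤ) : ℝ) (αp l) (βp l))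
    (hDR : AssumptionDR Γ t ω αl) :
    ∃ γ : ℝ, Tendsto (fun l : Λ => t l * Real.sqrt ((Γ l).b 0)) atTop (nhds γ) := by
  refine ⟨_, (tendsto_a_sub_div_sqrt hvar hd hcp hDR 0).neg.congr fun l => ?_⟩
  rw [(Γ l).a_zero]
  simp

theorem tendsto_beta_add_div_sqrt (hvar : ∀ l : Λ, 0 < sig2 Γ t l)
    (hd : Tendsto (fun l : Λ => (Γ l).d) atTop atTop) (hq2 : ∀ l : Λ, 2 ≤ |q l|)
    (hcp : ∀ l : Λ, (Γ l).HasClassical ((q l : ℤ) : ℝ) (αp l) (βp l)) {σ α : ℝ}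
    (hσ : Tendsto (fun l : Λ => ((Γ l).a 1 : ℝ) / Real.sqrt ((Γ l).b 0)) atTop (nhds σ))
    {F : Filter Λ} (hF : F ≤ atTop) (hα : ∀ᶠ l in F, αp l = α) :
    Tendsto (fun l : Λ => βp l / Real.sqrt ((Γ l).b 0)
      + α * gaussOne (q l) (Γ l).d / Real.sqrt ((Γ l).b 0)) F (nhds σ) := by
  have hsqrt : Tendsto (fun l : Λ => Real.sqrt ((Γ l).b 0)) atTop atTop :=
    Real.tendsto_sqrt_atTop.comp (tendsto_b_zero_atTop hvar hd hq2 hcp)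
  have h := (hσ.add (hsqrt.const_div_atTop (α + 1))).mono_left hF
  rw [add_zero] at h
  refine h.congr' ?_
  filter_upwards [hα, (hd.eventually_ge_atTop 1).filter_mono hF] with l hl hl1
  rw [(hcp l).a_one hl1, hl]
  ring

theorem limit_a_two_eq (hvar : ∀ l : Λ, 0 < sig2 Γ t l)
    (hd : Tendsto (fun l : Λ => (Γ l).d) atTop atTop) (hq2 : ∀ l : Λ, 2 ≤ |q l|)
    (hcp : ∀ l : Λ, (Γ l).HasClassical ((q l : ℤ) : ℝ) (αp l) (βp l)) {σ σ' α : ℝ}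
    (hσ : Tendsto (fun l : Λ => ((Γ l).a 1 : ℝ) / Real.sqrt ((Γ l).b 0)) atTop (nhds σ))
    (hσ' : Tendsto (fun l : Λ => ((Γ l).a 2 : ℝ) / Real.sqrt ((Γ l).b 0)) atTop (nhds σ'))
    {F : Filter Λ} [F.NeBot] (hF : F ≤ atTop) {n : ℕ} (hn : ∀ᶠ l in F, (Γ l).c 2 = n) {q₀ : ℤ}
    (hq : ∀ᶠ l in F, q l = q₀) (hα : ∀ᶠ l in F, αp l = α) : σ' = (1 + q₀) * σ := by
  have hsqrt : Tendsto (fun l : Λ => Real.sqrt ((Γ l).b 0)) atTop atTop :=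
    Real.tendsto_sqrt_atTop.comp (tendsto_b_zero_atTop hvar hd hq2 hcp)
  have h := ((tendsto_beta_add_div_sqrt hvar hd hq2 hcp hσ hF hα).const_mul (1 + (q₀ : ℝ))).sub
    ((hsqrt.const_div_atTop (α * (1 + q₀) ^ 2 + n)).mono_left hF)
  rw [sub_zero] at h
  refine tendsto_nhds_unique ((hσ'.mono_left hF).congr' ?_) h
  filter_upwards [hα, hn, hq, (hd.eventually_ge_atTop 2).filter_mono hF] with l h1 h2 h3 h4
  rw [(hcp l).a_eq one_le_two h4, h1, h2, h3, gaussOne_two]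
  ring

variable [IsDirected Λ (· ≤ ·)] [Nonempty Λ]

theorem eventually_c_eq (hvar : ∀ l : Λ, 0 < sig2 Γ t l)
    (hd : Tendsto (fun l : Λ => (Γ l).d) atTop atTop) (hq2 : ∀ l : Λ, 2 ≤ |q l|)
    (hcp : ∀ l : Λ, (Γ l).HasClassical ((q l : ℤ) : ℝ) (αp l) (βp l))
    (hDR : AssumptionDR Γ t ω αl) {i : ℕ} (h1 : 1 ≤ i) (hi : i ≤ 3) :
    ∃ n : ℕ, 0 < n ∧ ∀ᶠ l in (atTop : Filter Λ), (Γ l).c i = n := by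
  have hω := (hDR 1 le_rfl).1
  have hlim := ((hDR i h1).2.1.div (tendsto_b_zero_div_sig2 hd hcp hDR) hω.ne').div
    (tendsto_b_div_b_zero hvar hd hq2 hcp (i := i - 1) (by omega)) one_ne_zero
  have hne : ∀ᶠ l in (atTop : Filter Λ), ((Γ l).b (i - 1) : ℝ) / (Γ l).b 0 ≠ 0 :=
    (tendsto_b_div_b_zero hvar hd hq2 hcp (i := i - 1) (by omega)).eventually_ne one_ne_zero
  have hc : Tendsto (fun l : Λ => ((Γ l).c i : ℝ)) atTop (nhds (ω i / ω 1 / 1)) := by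
    refine hlim.congr' ?_
    filter_upwards [hne] with l hl
    have h2 : ((Γ l).b 0 : ℝ) ≠ 0 := by exact_mod_cast b_zero_ne_zero_of_sig2_pos (hvar l)
    have h3 := (hvar l).ne'
    have h4 : ((Γ l).b (i - 1) : ℝ) ≠ 0 := fun h => hl (by rw [h, zero_div])
    change omegaBar Γ t i l / (((Γ l).b 0 : ℝ) / sig2 Γ t l) /
      (((Γ l).b (i - 1) : ℝ) / (Γ l).b 0) = _
    rw [omegaBar]
    field_simp
  obtain ⟨n, hn, hev⟩ := exists_nat_of_tendsto_natCast hc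
  refine ⟨n, ?_, hev⟩
  have : (0 : ℝ) < n := by
    rw [← hn, div_one]
    exact div_pos (hDR i h1).1 hω
  exact_mod_cast this

theorem exists_tendsto_a_div_sqrt (hvar : ∀ l : Λ, 0 < sig2 Γ t l)
    (hd : Tendsto (fun l : Λ => (Γ l).d) atTop atTop)
    (hcp : ∀ l : Λ, (Γ l).HasClassical ((q l : ℤ) : ℝ) (αp l) (βp l))
    (hDR : AssumptionDR Γ t ω αl) (i : ℕ) :
    ∃ σ : ℝ, 0 ≤ σ ∧
      Tendsto (fun l : Λ => ((Γ l).a i : ℝ) / Real.sqrt ((Γ l).b 0)) atTop (nhds σ) := by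
  obtain ⟨γ, hγ⟩ := exists_tendsto_t_mul_sqrt hvar hd hcp hDR
  have h := ((tendsto_a_sub_div_sqrt hvar hd hcp hDR i).add hγ).congr
    (f₂ := fun l : Λ => ((Γ l).a i : ℝ) / Real.sqrt ((Γ l).b 0)) fun l => by ring
  exact ⟨_, ge_of_tendsto' h fun l => by positivity, h⟩

theorem neg_one_lt_of_tendsto (hvar : ∀ l : Λ, 0 < sig2 Γ t l)
    (hd : Tendsto (fun l : Λ => (Γ l).d) atTop atTop) (hq2 : ∀ l : Λ, 2 ≤ |q l|)
    (hcp : ∀ l : Λ, (Γ l).HasClassical ((q l : ℤ) : ℝ) (αp l) (βp l))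
    (hDR : AssumptionDR Γ t ω αl) {γ σ : ℝ}
    (hγ : Tendsto (fun l : Λ => t l * Real.sqrt ((Γ l).b 0)) atTop (nhds γ))
    (hσ : Tendsto (fun l : Λ => ((Γ l).a 1 : ℝ) / Real.sqrt ((Γ l).b 0)) atTop (nhds σ)) :
    -1 < γ * σ := by
  have hω := (hDR 1 le_rfl).1
  have hsqrt : Tendsto (fun l : Λ => Real.sqrt ((Γ l).b 0)) atTop atTop :=
    Real.tendsto_sqrt_atTop.comp (tendsto_b_zero_atTop hvar hd hq2 hcp)
  have ht : Tendsto t atTop (nhds 0) := by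
    refine (hγ.div_atTop hsqrt).congr fun l => ?_
    exact mul_div_cancel_right₀ _ (sqrt_b_zero_pos_of_sig2_pos (hvar l)).ne'
  have h1 : Tendsto (fun l : Λ => (1 - t l) * (1 + t l + t l * Real.sqrt ((Γ l).b 0) *
      (((Γ l).a 1 : ℝ) / Real.sqrt ((Γ l).b 0)))) atTop (nhds ((1 - 0) * (1 + 0 + γ * σ))) :=
    (ht.const_sub 1).mul ((ht.const_add 1).add (hγ.mul hσ))
  have h2 : Tendsto (fun l : Λ => (1 - t l) * (1 + t l + t l * Real.sqrt ((Γ l).b 0) *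
      (((Γ l).a 1 : ℝ) / Real.sqrt ((Γ l).b 0)))) atTop (nhds (ω 1)⁻¹) := by
    refine ((tendsto_b_zero_div_sig2 hd hcp hDR).inv₀ hω.ne').congr fun l => ?_
    have h3 := (sqrt_b_zero_pos_of_sig2_pos (hvar l)).ne'
    have h4 : ((Γ l).b 0 : ℝ) ≠ 0 := by exact_mod_cast b_zero_ne_zero_of_sig2_pos (hvar l)
    rw [inv_div, sig2]
    field_simp
  have h3 := tendsto_nhds_unique h1 h2
  have := inv_pos.2 hω
  linarith

end ClassicalNet

open Polynomial in
theorem exists_finset_roots_cubic (m n : ℤ) :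
    ∃ S : Finset ℤ, S.card ≤ 3 ∧ ∀ x : ℤ, n = (1 + x + x ^ 2) * (m - x) → x ∈ S := by
  let p : ℤ[X] := X ^ 3 + C (1 - m) * X ^ 2 + C (1 - m) * X + C (n - m)
  have hdeg : p.natDegree = 3 := by
    simp only [p]
    compute_degree!
  have hp : p ≠ 0 := by
    intro h
    rw [h, natDegree_zero] at hdeg
    omega
  refine ⟨p.roots.toFinset, ?_, fun x hx => ?_⟩
  · exact (Multiset.toFinset_card_le _).trans ((card_roots' p).trans hdeg.le)
  · rw [Multiset.mem_toFinset, mem_roots hp, IsRoot.def]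
    simp only [p, eval_add, eval_mul, eval_pow, eval_X, eval_C]
    linear_combination hx

theorem eq_of_cubic_eq_of_le_neg_two {m x y : ℤ} (hm : 0 < m) (hx : x ≤ -2) (hy : y ≤ -2)
    (h : (1 + x + x ^ 2) * (m - x) = (1 + y + y ^ 2) * (m - y)) : x = y := by
  have key : ∀ u v : ℤ, u < v → v ≤ -2 →
      (1 + v + v ^ 2) * (m - v) < (1 + u + u ^ 2) * (m - u) := by
    intro u v huv hv
    exact mul_lt_mul'' (by nlinarith) (by linarith) (by nlinarith) (by linarith)
  rcases lt_trichotomy x y with hxy | hxy | hxy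
  · exact absurd h (key x y hxy hy).ne'
  · exact hxy
  · exact absurd h (key y x hxy hx).ne

section SumProduct

variable {ι : Type*} {F : Filter ι} {x y : ι → ℝ} {σ α : ℝ}

theorem four_mul_le_sq_of_tendsto [F.NeBot] (hxy : ∀ l, x l * y l = α)
    (h : Tendsto (fun l => x l + y l) F (nhds σ)) : 4 * α ≤ σ ^ 2 :=
  ge_of_tendsto' (h.pow 2) fun l => by
    rw [← hxy l]
    nlinarith [sq_nonneg (x l - y l)]

theorem sq_eq_sub_of_mul_eq (hxy : ∀ l, x l * y l = α) (l : ι) :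
    x l ^ 2 - (x l + y l) * x l + α = 0 := by
  rw [← hxy l]; ring

theorem eventually_abs_le_of_tendsto (hxy : ∀ l, x l * y l = α)
    (h : Tendsto (fun l => x l + y l) F (nhds σ)) : ∃ C : ℝ, ∀ᶠ l in F, |x l| ≤ C := by
  refine ⟨|σ| + 1 + |α| + 1, ?_⟩
  filter_upwards [h.abs.eventually_le_const (lt_add_one _)] with l hl
  by_contra! hc
  have h1 : |x l| * |x l| ≤ |x l + y l| * |x l| + |α| := by
    rw [← abs_mul, ← abs_mul]
    refine le_trans (le_of_eq ?_) (abs_sub _ _)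
    congr 1
    linear_combination sq_eq_sub_of_mul_eq hxy l
  nlinarith [abs_nonneg α, abs_nonneg σ]

theorem quadratic_of_mapClusterPt (hxy : ∀ l, x l * y l = α)
    (h : Tendsto (fun l => x l + y l) F (nhds σ)) {z : ℝ} (hz : MapClusterPt z F x) :
    z ^ 2 - σ * z + α = 0 := by
  obtain ⟨U, hU, hUz⟩ := mapClusterPt_iff_ultrafilter.1 hz
  have h1 := ((hUz.pow 2).sub ((h.mono_left hU).mul hUz)).add_const α
  refine tendsto_nhds_unique h1 (tendsto_const_nhds.congr fun l => ?_)
  exact (sq_eq_sub_of_mul_eq hxy l).symm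

end SumProduct

theorem exists_pos_add_div_eq {σ α : ℝ} (hσ : 0 ≤ σ) (hα : α ≠ 0) (h : 4 * α ≤ σ ^ 2) :
    ∃ ρ : ℝ, 0 < ρ ∧ ρ + α / ρ = σ := by
  have hs := Real.sq_sqrt (sub_nonneg.2 h)
  have hs0 := Real.sqrt_nonneg (σ ^ 2 - 4 * α)
  have hρ : 0 < (σ + Real.sqrt (σ ^ 2 - 4 * α)) / 2 := by
    refine half_pos ((add_nonneg hσ hs0).lt_of_ne' fun h0 => hα ?_)
    have h1 : σ = 0 := by linarith
    have h2 : Real.sqrt (σ ^ 2 - 4 * α) = 0 := by linarith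
    rw [h2, h1] at hs
    linarith
  have hne : σ + Real.sqrt (σ ^ 2 - 4 * α) ≠ 0 := by linarith
  refine ⟨_, hρ, ?_⟩
  field_simp
  linear_combination hs

/-- Scaling-limit classification for graphs with classical parameters (`q ≠ 1`):
`q` eventually takes at most three values; if `q` is eventually constant then so is
`α`, and cases (i)/(ii) hold; if `q` is not convergent then there is a subnet
(a finer nontrivial filter) on which `q` is eventually constant and (ii) holds
with `ρ = 0`. -/
theorem stmt17 {Λ : Type*} [Preorder Λ] [IsDirected Λ (· ≤ ·)] [Nonempty Λ] [Infinite Λ]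
    (Γ : Λ → DRG) (t : Λ → ℝ)
    (hpi : ∀ l : Λ, (Γ l).piMem (t l))
    (hvar : ∀ l : Λ, 0 < sig2 Γ t l)
    (hd : Tendsto (fun l : Λ => (Γ l).d) atTop atTop)
    (q : Λ → ℤ) (αp βp : Λ → ℝ)
    (hd3 : ∀ l : Λ, 3 ≤ (Γ l).d)
    (hq2 : ∀ l : Λ, 2 ≤ |q l|)
    (hcp : ∀ l : Λ, (Γ l).HasClassical ((q l : ℤ) : ℝ) (αp l) (βp l))
    (ω αl : ℕ → ℝ) (hDR : AssumptionDR Γ t ω αl) :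
    (∃ S : Finset ℤ, S.card ≤ 3 ∧ ∀ᶠ l in (atTop : Filter Λ), q l ∈ S) ∧
    (∀ q0 : ℤ, (∀ᶠ l in (atTop : Filter Λ), q l = q0) →
      ∃ α0 : ℝ, (∀ᶠ l in (atTop : Filter Λ), αp l = α0) ∧
        (α0 ≠ 0 →
          (∃ C : ℝ, ∀ᶠ l in (atTop : Filter Λ),
            |βp l / Real.sqrt ((Γ l).b 0)| ≤ C) ∧
          ∃ γ ρ : ℝ, 0 < ρ ∧ -1 < γ * (ρ + α0 / ρ) ∧
            Tendsto (fun l : Λ => t l * Real.sqrt ((Γ l).b 0)) atTop (nhds γ) ∧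
            (∀ x : ℝ, MapClusterPt x atTop
                (fun l : Λ => βp l / Real.sqrt ((Γ l).b 0)) →
              x = ρ ∨ x = α0 / ρ) ∧
            (q0 < 0 → ρ = Real.sqrt (-α0))) ∧
        (α0 = 0 →
          ∃ γ ρ : ℝ, 0 ≤ ρ ∧ -1 < γ * ρ ∧
            Tendsto (fun l : Λ => t l * Real.sqrt ((Γ l).b 0)) atTop (nhds γ) ∧
            Tendsto (fun l : Λ => βp l / Real.sqrt ((Γ l).b 0)) atTop (nhds ρ))) ∧
    ((¬ ∃ L : ℤ, Tendsto q atTop (nhds L)) →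
      ∃ F : Filter Λ, F.NeBot ∧ F ≤ atTop ∧ (∃ q0 : ℤ, ∀ᶠ l in F, q l = q0) ∧
        ∃ γ : ℝ, Tendsto (fun l : Λ => t l * Real.sqrt ((Γ l).b 0)) F (nhds γ) ∧
          Tendsto (fun l : Λ => βp l / Real.sqrt ((Γ l).b 0)) F (nhds 0)) := by
  obtain ⟨n₂, hn₂, hc₂⟩ := eventually_c_eq hvar hd hq2 hcp hDR (i := 2) (by omega) (by omega)
  obtain ⟨n₃, hn₃, hc₃⟩ := eventually_c_eq hvar hd hq2 hcp hDR (i := 3) (by omega) (by omega)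
  obtain ⟨γ, hγ⟩ := exists_tendsto_t_mul_sqrt hvar hd hcp hDR
  obtain ⟨σ, hσ0, hσ⟩ := exists_tendsto_a_div_sqrt hvar hd hcp hDR 1
  obtain ⟨σ', hσ0', hσ'⟩ := exists_tendsto_a_div_sqrt hvar hd hcp hDR 2
  have hγσ : -1 < γ * σ := neg_one_lt_of_tendsto hvar hd hq2 hcp hDR hγ hσ
  have hcubic : ∀ᶠ l in (atTop : Filter Λ), (n₃ : ℤ) = (1 + q l + q l ^ 2) * (n₂ - q l) := by
    filter_upwards [hc₂, hc₃] with l h2 h3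
    rw [← h2, ← h3]
    exact c_three_eq hcp (hd3 l)
  have hα : ∀ {F : Filter Λ} {q₀ : ℤ}, F ≤ atTop → (∀ᶠ l in F, q l = q₀) →
      ∀ᶠ l in F, αp l = n₂ / (1 + q₀) - 1 := by
    intro F q₀ hF hq
    filter_upwards [hc₂.filter_mono hF, hq] with l h2 h3
    rw [alpha_eq_of_c_two hcp hq2 ((by norm_num : 2 ≤ 3).trans (hd3 l)), h2, h3]
  have hbeta : ∀ {F : Filter Λ} {q₀ : ℤ}, F ≤ atTop → (∀ᶠ l in F, q l = q₀) →
      (n₂ / (1 + q₀) - 1 : ℝ) = 0 →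
      Tendsto (fun l : Λ => βp l / Real.sqrt ((Γ l).b 0)) F (nhds σ) := by
    intro F q₀ hF hq h0
    have h := tendsto_beta_add_div_sqrt hvar hd hq2 hcp hσ hF (hα hF hq)
    rw [h0] at h
    simpa using h
  have hsigma : ∀ {F : Filter Λ} [F.NeBot] {q₀ : ℤ}, F ≤ atTop → (∀ᶠ l in F, q l = q₀) →
      σ' = (1 + q₀) * σ := fun hF hq =>
    limit_a_two_eq hvar hd hq2 hcp hσ hσ' hF (hc₂.filter_mono hF) hq (hα hF hq)
  obtain ⟨S, hS, hroots⟩ := exists_finset_roots_cubic n₂ n₃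
  have hqS : ∀ᶠ l in (atTop : Filter Λ), q l ∈ S := hcubic.mono fun l hl => hroots _ hl
  refine ⟨⟨S, hS, hqS⟩, fun q₀ hq₀ => ⟨_, hα le_rfl hq₀, fun hne => ?_, fun h0 => ?_⟩, fun hnc => ?_⟩
  · have hsum := tendsto_beta_add_div_sqrt hvar hd hq2 hcp hσ le_rfl (hα le_rfl hq₀)
    have hprod := beta_div_mul_alpha_div hvar hcp (n₂ / (1 + q₀) - 1 : ℝ)
    obtain ⟨ρ, hρ, hρσ⟩ := exists_pos_add_div_eq hσ0 hne (four_mul_le_sq_of_tendsto hprod hsum)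
    refine ⟨eventually_abs_le_of_tendsto hprod hsum, γ, ρ, hρ, by rwa [hρσ], hγ,
      fun z hz => ?_, fun hneg => ?_⟩
    · have hquad := quadratic_of_mapClusterPt hprod hsum hz
      have hfac : (z - ρ) * (z - (n₂ / (1 + q₀) - 1 : ℝ) / ρ) = 0 := by
        have hρ' : ρ * ((n₂ / (1 + q₀) - 1 : ℝ) / ρ) = n₂ / (1 + q₀) - 1 :=
          mul_div_cancel₀ _ hρ.ne'
        linear_combination hquad - z * hρσ + hρ'
      rcases mul_eq_zero.1 hfac with h | h
      · exact Or.inl (sub_eq_zero.1 h)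
      · exact Or.inr (sub_eq_zero.1 h)
    · have hq₀' : q₀ ≤ -2 := by
        obtain ⟨l, hl⟩ := hq₀.exists
        have h2 := hq2 l
        rw [hl, abs_of_neg hneg] at h2
        omega
      have hq₀'' : (q₀ : ℝ) ≤ -2 := by exact_mod_cast hq₀'
      have hs : σ' = (1 + q₀) * σ := hsigma le_rfl hq₀
      have hσz : σ = 0 := by nlinarith
      rw [hσz] at hρσ
      have hsq : -(n₂ / (1 + q₀) - 1 : ℝ) = ρ ^ 2 := by
        field_simp at hρσ
        linear_combination -hρσ
      rw [hsq, Real.sqrt_sq hρ.le]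
  · exact ⟨γ, σ, hσ0, hγσ, hγ, hbeta le_rfl hq₀ h0⟩
  · have hfreq : ∃ᶠ l in (atTop : Filter Λ), ∃ m ∈ S, q l = m :=
      hqS.frequently.mono fun l hl => ⟨q l, hl, rfl⟩
    obtain ⟨q₁, -, hq₁⟩ := (S.frequently_exists).1 hfreq
    have hne : ∃ᶠ l in (atTop : Filter Λ), q l ≠ q₁ := by
      intro h
      refine hnc ⟨q₁, ?_⟩
      rw [nhds_discrete, tendsto_pure]
      exact h.mono fun l hl => not_not.1 hl
    have hfreq' : ∃ᶠ l in (atTop : Filter Λ), ∃ m ∈ S, q l = m ∧ m ≠ q₁ :=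
      (hne.and_eventually hqS).mono fun l hl => ⟨q l, hl.2, rfl, hl.1⟩
    obtain ⟨q₂, -, hq₂⟩ := (S.frequently_exists).1 hfreq'
    have h21 : q₂ ≠ q₁ := by
      obtain ⟨l, hl⟩ := hq₂.exists
      exact hl.2
    have hq₂' : ∃ᶠ l in (atTop : Filter Λ), q l = q₂ := hq₂.mono fun l hl => hl.1
    have hsub : ∀ {m : ℤ}, (∃ᶠ l in (atTop : Filter Λ), q l = m) →
        (atTop ⊓ 𝓟 {l | q l = m}).NeBot ∧ ∀ᶠ l in atTop ⊓ 𝓟 {l | q l = m}, q l = m :=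
      fun h => ⟨frequently_mem_iff_neBot.1 h, eventually_inf_principal.2 (Eventually.of_forall
        fun _ h => h)⟩
    have hσz : σ = 0 := by
      obtain ⟨_, he₁⟩ := hsub hq₁
      obtain ⟨_, he₂⟩ := hsub hq₂'
      have h1 := hsigma inf_le_left he₁
      have h2 := hsigma inf_le_left he₂
      have h3 : ((q₂ : ℝ) - q₁) * σ = 0 := by linarith
      exact (mul_eq_zero.1 h3).resolve_left (sub_ne_zero.2 (by exact_mod_cast h21))
    have hpos : ∀ {m : ℤ}, (∃ᶠ l in (atTop : Filter Λ), q l = m) → 0 < m →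
        (n₂ / (1 + m) - 1 : ℝ) = 0 := by
      intro m hm hm0
      obtain ⟨_, he⟩ := hsub hm
      have h4 := four_mul_le_sq_of_tendsto (beta_div_mul_alpha_div hvar hcp _)
        (tendsto_beta_add_div_sqrt hvar hd hq2 hcp hσ inf_le_left (hα inf_le_left he))
      rw [hσz] at h4
      obtain ⟨l, hl, hl'⟩ := (hm.and_eventually hcubic).exists
      rw [hl] at hl'
      have h5 : m < n₂ := by
        by_contra! hle
        have : (0 : ℤ) < n₃ := by exact_mod_cast hn₃
        nlinarith
      have h6 : (1 + m : ℝ) ≤ n₂ := by exact_mod_cast (by omega : 1 + m ≤ n₂)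
      have h7 : (0 : ℝ) < 1 + m := by exact_mod_cast (by omega : 0 < 1 + m)
      have h8 := (one_le_div h7).2 h6
      linarith
    obtain ⟨m, hm, hm0⟩ : ∃ m : ℤ, (∃ᶠ l in (atTop : Filter Λ), q l = m) ∧ 0 < m := by
      by_contra! hnone
      have hle : ∀ {m : ℤ}, (∃ᶠ l in (atTop : Filter Λ), q l = m) →
          m ≤ -2 ∧ (n₃ : ℤ) = (1 + m + m ^ 2) * (n₂ - m) := by
        intro m hm
        obtain ⟨l, hl, hl'⟩ := (hm.and_eventually hcubic).exists
        have h2 := hq2 l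
        rw [hl] at h2 hl'
        rw [abs_of_nonpos (hnone m hm)] at h2
        exact ⟨by omega, hl'⟩
      obtain ⟨h1, h1'⟩ := hle hq₁
      obtain ⟨h2, h2'⟩ := hle hq₂'
      exact h21 (eq_of_cubic_eq_of_le_neg_two (by exact_mod_cast hn₂) h2 h1 (h2'.symm.trans h1'))
    obtain ⟨hbot, he⟩ := hsub hm
    refine ⟨_, hbot, inf_le_left, ⟨m, he⟩, γ, hγ.mono_left inf_le_left, ?_⟩
    have hb := hbeta inf_le_left he (hpos hm hm0)
    rwa [hσz] at hb
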